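/- Let G be a finite simple graph with independence number 3, let a₁ be the number of vertices of G, a₂ the number of 2-element independent sets, and a₃ the number of 3-element independent sets, and let P(z) = a₁z + a₂z² + a₃z³ as a map ℂ → ℂ. Suppose a₁ ≥ 4 and a₂²·(a₁ − 3) = 4·a₃·(a₁ − 2)². Then: if a₁ ≤ 7 the Julia set J(P) is connected, and if a₁ > 7 the Julia set J(P) is not connected but is not totally disconnected (it contains a connected subset with at least two distinct points). -/

import Mathlib

/-- The filled-in Julia set of a self-map of the complex plane. -/
def filledJulia (f : ℂ → ℂ) : Set ℂ :=
  {z : ℂ | Bornology.IsBounded (Set.range fun n => f^[n] z)}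

lemma mem_filledJulia {f : ℂ → ℂ} {z : ℂ} :
    z ∈ filledJulia f ↔ Bornology.IsBounded (Set.range fun n => f^[n] z) := Iff.rfl

section Escape

variable {f : ℂ → ℂ} {R : ℝ}

lemma two_pow_mul_norm_le_norm_iterate (hf : ∀ z, R ≤ ‖z‖ → 2 * ‖z‖ ≤ ‖f z‖) {z : ℂ}
    (hz : R ≤ ‖z‖) (n : ℕ) : 2 ^ n * ‖z‖ ≤ ‖f^[n] z‖ := by
  induction n with
  | zero => simp
  | succ n ih =>
    rw [Function.iterate_succ_apply']
    have h1 : (1 : ℝ) ≤ 2 ^ n := one_le_pow₀ (by norm_num)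
    have h2 : R ≤ ‖f^[n] z‖ := by nlinarith [norm_nonneg z]
    have := hf _ h2
    rw [pow_succ]
    linarith

lemma lt_norm_iterate (hR : 0 < R) (hf : ∀ z, R ≤ ‖z‖ → 2 * ‖z‖ ≤ ‖f z‖) {z : ℂ} {m n : ℕ}
    (hz : R ≤ ‖f^[m] z‖) (hmn : m < n) : R < ‖f^[n] z‖ := by
  obtain ⟨k, rfl⟩ := Nat.exists_eq_add_of_lt hmn
  have h := two_pow_mul_norm_le_norm_iterate hf hz (k + 1)
  rw [← Function.iterate_add_apply] at h
  have h1 : (1 : ℝ) ≤ 2 ^ k := one_le_pow₀ (by norm_num)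
  rw [show m + k + 1 = k + 1 + m by ring]
  rw [pow_succ] at h
  nlinarith

lemma mem_filledJulia_iff (hR : 0 < R) (hf : ∀ z, R ≤ ‖z‖ → 2 * ‖z‖ ≤ ‖f z‖) {z : ℂ} :
    z ∈ filledJulia f ↔ ∀ n, ‖f^[n] z‖ < R := by
  constructor
  · intro hz n
    by_contra! hn
    obtain ⟨C, hC⟩ := (mem_filledJulia.1 hz).exists_norm_le
    obtain ⟨k, hk⟩ := pow_unbounded_of_one_lt (C / R) (one_lt_two : (1 : ℝ) < 2)
    have h := two_pow_mul_norm_le_norm_iterate hf hn k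
    rw [← Function.iterate_add_apply] at h
    have h' := hC _ ⟨k + n, rfl⟩
    rw [div_lt_iff₀ hR] at hk
    have : (0 : ℝ) < 2 ^ k := by positivity
    simp only at h'
    nlinarith
  · intro h
    refine mem_filledJulia.2 (isBounded_iff_forall_norm_le.2 ⟨R, ?_⟩)
    rintro _ ⟨n, rfl⟩
    exact (h n).le

lemma isClosed_filledJulia (hc : Continuous f) (hR : 0 < R)
    (hf : ∀ z, R ≤ ‖z‖ → 2 * ‖z‖ ≤ ‖f z‖) : IsClosed (filledJulia f) := by
  have : filledJulia f = ⋂ n, {z | ‖f^[n] z‖ ≤ R} := by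
    ext z
    rw [mem_filledJulia_iff hR hf]
    simp only [Set.mem_iInter, Set.mem_ofPred_eq]
    refine ⟨fun h n => (h n).le, fun h n => ?_⟩
    by_contra! hn
    exact absurd (h (n + 1)) (not_le.2 (lt_norm_iterate hR hf hn n.lt_succ_self))
  rw [this]
  exact isClosed_iInter fun n => isClosed_le (hc.iterate n).norm continuous_const

lemma isBounded_filledJulia (hR : 0 < R) (hf : ∀ z, R ≤ ‖z‖ → 2 * ‖z‖ ≤ ‖f z‖) :
    Bornology.IsBounded (filledJulia f) :=
  isBounded_iff_forall_norm_le.2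
    ⟨R, fun _ hz => ((mem_filledJulia_iff hR hf).1 hz 0).le⟩

lemma isCompact_frontier_filledJulia (hc : Continuous f) (hR : 0 < R)
    (hf : ∀ z, R ≤ ‖z‖ → 2 * ‖z‖ ≤ ‖f z‖) : IsCompact (frontier (filledJulia f)) :=
  Metric.isCompact_of_isClosed_isBounded isClosed_frontier
    ((isBounded_filledJulia hR hf).subset (isClosed_filledJulia hc hR hf).frontier_subset)

lemma exists_level_subset_of_frontier_subset (hc : Continuous f) (hR : 0 < R)
    (hf : ∀ z, R ≤ ‖z‖ → 2 * ‖z‖ ≤ ‖f z‖) {W : Set ℂ} (hW : IsOpen W)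
    (hJ : frontier (filledJulia f) ⊆ W) :
    ∃ N, ∀ n ≥ N, {z | ‖f^[n] z‖ = R} ⊆ W := by
  have hcpt : IsCompact (Metric.closedBall (0 : ℂ) R \ W) := (isCompact_closedBall 0 R).diff hW
  have hcover : Metric.closedBall (0 : ℂ) R \ W ⊆
      ⋃ n, (interior (filledJulia f) ∪ {z | R < ‖f^[n] z‖}) := by
    rintro z ⟨-, hz⟩
    rw [Set.mem_iUnion]
    by_cases hzi : z ∈ interior (filledJulia f)
    · exact ⟨0, Or.inl hzi⟩
    have hzK : z ∉ filledJulia f := fun h => hz (hJ ⟨subset_closure h, hzi⟩)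
    rw [mem_filledJulia_iff hR hf] at hzK
    push Not at hzK
    obtain ⟨n, hn⟩ := hzK
    exact ⟨n + 1, Or.inr (lt_norm_iterate hR hf hn n.lt_succ_self)⟩
  obtain ⟨N, hN⟩ := hcpt.elim_directed_cover _
    (fun n => isOpen_interior.union (isOpen_lt continuous_const (hc.iterate n).norm)) hcover
    (Monotone.directed_le (by
      intro m n hmn
      refine Set.union_subset_union_right _ fun z hz => ?_
      rcases hmn.eq_or_lt with rfl | h
      · exact hz
      · exact lt_norm_iterate hR hf (le_of_lt hz) h))
  refine ⟨N, fun n hn z hz => ?_⟩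
  by_contra hzW
  have hz' : ‖f^[n] z‖ = R := hz
  have hzR : ‖z‖ ≤ R := by
    by_contra! h
    have := two_pow_mul_norm_le_norm_iterate hf h.le n
    have h1 : (1 : ℝ) ≤ 2 ^ n := one_le_pow₀ (by norm_num)
    nlinarith
  rcases hN ⟨by simpa using hzR, hzW⟩ with h | h
  · exact absurd ((mem_filledJulia_iff hR hf).1 (interior_subset h) n) (by simp [hz'])
  · rcases hn.eq_or_lt with rfl | hlt
    · exact absurd hz' (ne_of_gt h)
    · exact absurd hz' (ne_of_gt (lt_norm_iterate hR hf (le_of_lt h) hlt))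

lemma exists_level_inter_nonempty (hc : Continuous f) (hR : 0 < R)
    (hf : ∀ z, R ≤ ‖z‖ → 2 * ‖z‖ ≤ ‖f z‖) {W : Set ℂ} (hW : IsOpen W)
    (hJ : (frontier (filledJulia f) ∩ W).Nonempty) :
    ∃ N, ∀ n ≥ N, ({z | ‖f^[n] z‖ = R} ∩ W).Nonempty := by
  obtain ⟨x, hx, hxW⟩ := hJ
  obtain ⟨r, hr, hrW⟩ := Metric.isOpen_iff.1 hW x hxW
  have hxK := (isClosed_filledJulia hc hR hf).frontier_subset hx
  obtain ⟨y, hyr, hyK⟩ : ∃ y ∈ Metric.ball x r, y ∉ filledJulia f := by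
    by_contra! h
    exact hx.2 (mem_interior.2 ⟨_, h, Metric.isOpen_ball, Metric.mem_ball_self hr⟩)
  rw [mem_filledJulia_iff hR hf] at hyK hxK
  push Not at hyK
  obtain ⟨N, hN⟩ := hyK
  refine ⟨N + 1, fun n hn => ?_⟩
  have hy := lt_norm_iterate hR hf hN (Nat.lt_of_succ_le hn)
  obtain ⟨z, hz, hzR⟩ := (convex_ball x r).isPreconnected.intermediate_value
    (Metric.mem_ball_self hr) hyr (hc.iterate n).norm.continuousOn ⟨(hxK n).le, hy.le⟩
  exact ⟨z, hzR, hrW hz⟩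

/-- If all the level curves `‖fⁿ‖ = R` are connected then so is the Julia set. -/
lemma isPreconnected_frontier_filledJulia (hc : Continuous f) (hR : 0 < R)
    (hf : ∀ z, R ≤ ‖z‖ → 2 * ‖z‖ ≤ ‖f z‖)
    (hL : ∀ n, IsPreconnected {z | ‖f^[n] z‖ = R}) :
    IsPreconnected (frontier (filledJulia f)) := by
  intro U V hU hV hUV hJU hJV
  by_contra hne
  rw [Set.not_nonempty_iff_eq_empty] at hne
  have hJ := isCompact_frontier_filledJulia hc hR hf
  set J := frontier (filledJulia f)
  obtain ⟨U', V', hU', hV', hUU', hVV', hdisj⟩ : SeparatedNhds (J \ V) (J \ U) := by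
    refine SeparatedNhds.of_isCompact_isCompact (hJ.diff hV) (hJ.diff hU) ?_
    rw [Set.disjoint_left]
    rintro z ⟨hz, hzV⟩ ⟨-, hzU⟩
    exact (hUV hz).elim hzU hzV
  have hJ' : J ⊆ U' ∪ V' := fun z hz => by
    by_cases hzV : z ∈ V
    · exact Or.inr (hVV' ⟨hz, fun hzU => (hne.le ⟨hz, hzU, hzV⟩).elim⟩)
    · exact Or.inl (hUU' ⟨hz, hzV⟩)
  have hJU' : (J ∩ U').Nonempty := by
    obtain ⟨z, hz, hzU⟩ := hJU
    exact ⟨z, hz, hUU' ⟨hz, fun hzV => (hne.le ⟨hz, hzU, hzV⟩).elim⟩⟩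
  have hJV' : (J ∩ V').Nonempty := by
    obtain ⟨z, hz, hzV⟩ := hJV
    exact ⟨z, hz, hVV' ⟨hz, fun hzU => (hne.le ⟨hz, hzU, hzV⟩).elim⟩⟩
  obtain ⟨N₁, h₁⟩ := exists_level_subset_of_frontier_subset hc hR hf (hU'.union hV') hJ'
  obtain ⟨N₂, h₂⟩ := exists_level_inter_nonempty hc hR hf hU' hJU'
  obtain ⟨N₃, h₃⟩ := exists_level_inter_nonempty hc hR hf hV' hJV'
  let n := max N₁ (max N₂ N₃)
  obtain ⟨z, -, hz⟩ := hL n U' V' hU' hV' (h₁ n (by simp [n])) (h₂ n (by simp [n]))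
    (h₃ n (by simp [n]))
  exact Set.disjoint_left.1 hdisj hz.1 hz.2

lemma frontier_filledJulia_nonempty (hR : 0 < R) (hf : ∀ z, R ≤ ‖z‖ → 2 * ‖z‖ ≤ ‖f z‖)
    (hne : (filledJulia f).Nonempty) : (frontier (filledJulia f)).Nonempty := by
  refine nonempty_frontier_iff.2 ⟨hne, fun h => ?_⟩
  have : (R : ℂ) ∈ filledJulia f := h ▸ Set.mem_univ _
  have := (mem_filledJulia_iff hR hf).1 this 0
  simp [abs_of_pos hR] at this

end Escape

open Complex in
lemma not_exists_continuous_exp_eq_sub {p : ℂ} {r : ℝ} (hr : 0 < r) :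
    ¬ ∃ g : ℂ → ℂ, Continuous g ∧ ∀ z ∈ Metric.sphere p r, exp (g z) = z - p := by
  rintro ⟨g, hg, h⟩
  let k : ℝ → ℂ := fun θ => g (circleMap p r θ) - θ * I
  have hk : Continuous k := by
    have := continuous_circleMap p r
    fun_prop
  have hexp : ∀ θ, exp (k θ) = r := by
    intro θ
    have hr' : (r : ℂ) ≠ 0 := by exact_mod_cast hr.ne'
    rw [exp_sub, h _ (circleMap_mem_sphere p hr.le θ), circleMap, add_sub_cancel_left,
      mul_div_assoc, div_self (exp_ne_zero _), mul_one]
  have hconst : k (2 * Real.pi) = k 0 := by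
    have hcov : IsCoveringMap fun z : ℂ ↦ (⟨_, z.exp_ne_zero⟩ : {z : ℂ // z ≠ 0}) :=
      isCoveringMap_exp
    exact hcov.const_of_comp hk (fun a a' => Subtype.ext (by simp [hexp])) _ _
  have hper : circleMap p r (2 * Real.pi) = circleMap p r 0 := by
    simpa using periodic_circleMap p r 0
  simp only [k, hper] at hconst
  have : (2 * Real.pi : ℂ) * I = 0 := by
    push_cast at hconst
    linear_combination -hconst
  simp [Real.pi_ne_zero] at this

/-- A nowhere vanishing continuous function on a compact totally disconnected set has a continuous
logarithm. -/
lemma exists_continuous_exp_eq_of_totallyDisconnected {X : Type*} [TopologicalSpace X]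
    [CompactSpace X] [T2Space X] [TotallyDisconnectedSpace X] (f : C(X, ℂ)) (hf : ∀ x, f x ≠ 0) :
    ∃ g : C(X, ℂ), ∀ x, Complex.exp (g x) = f x := by
  let F : C(X, {z : ℂ // z ≠ 0}) := ⟨fun x => ⟨f x, hf x⟩, by fun_prop⟩
  have hS : {q : {z : ℂ // z ≠ 0} × {z : ℂ // z ≠ 0} | ‖(q.1 : ℂ) - q.2‖ < ‖(q.1 : ℂ)‖} ∈
      nhdsSet (Set.diagonal {z : ℂ // z ≠ 0}) := by
    refine IsOpen.mem_nhdsSet (isOpen_lt (by fun_prop) (by fun_prop)) |>.2 ?_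
    rintro ⟨a, b⟩ (rfl : a = b)
    simp [a.2]
  obtain ⟨n, i, h, hi, hh⟩ := F.exists_finite_approximation_of_mem_nhds_diagonal hS
  have hslit : ∀ x, (h (i x) : ℂ) / f x ∈ Complex.slitPlane := by
    intro x
    have h1 : ‖f x - h (i x)‖ < ‖f x‖ := hh x
    refine Or.inl ?_
    have h2 : ‖1 - (h (i x) : ℂ) / f x‖ < 1 := by
      rw [show 1 - (h (i x) : ℂ) / f x = (f x - h (i x)) / f x by field_simp [hf x], norm_div]
      exact (div_lt_one (norm_pos_iff.2 (hf x))).2 h1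
    have h3 := (Complex.abs_re_le_norm _).trans_lt h2
    rw [Complex.sub_re, Complex.one_re, abs_lt] at h3
    linarith
  have hcont : Continuous fun x => (h (i x) : ℂ) :=
    (continuous_of_discreteTopology (f := fun j => (h j : ℂ))).comp hi
  refine ⟨⟨fun x => Complex.log (h (i x)) - Complex.log (h (i x) / f x), ?_⟩, fun x => ?_⟩
  · exact ((continuous_of_discreteTopology (f := fun j => Complex.log (h j))).comp hi).sub
      ((hcont.div f.continuous hf).clog hslit)
  · have h0 := (h (i x)).2
    simp only [ContinuousMap.coe_mk]
    rw [Complex.exp_sub, Complex.exp_log h0, Complex.exp_log (div_ne_zero h0 (hf x))]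
    field_simp [hf x]

/-- The frontier of a nonempty bounded open subset of the plane is not totally disconnected. -/
lemma not_isTotallyDisconnected_frontier {U : Set ℂ} (hU : IsOpen U) (hne : U.Nonempty)
    (hb : Bornology.IsBounded U) : ¬ IsTotallyDisconnected (frontier U) := by
  intro htd
  obtain ⟨p, hp⟩ := hne
  obtain ⟨r, hr, hUr⟩ := hb.subset_ball_lt 0 p
  have hcpt : IsCompact (frontier U) :=
    Metric.isCompact_of_isClosed_isBounded isClosed_frontier
      (hb.closure.subset frontier_subset_closure)
  have := isCompact_iff_compactSpace.1 hcpt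
  have := totallyDisconnectedSpace_subtype_iff.2 htd
  have hpU : ∀ z ∈ frontier U, z - p ≠ 0 := by
    rintro z hz h
    rw [sub_eq_zero] at h
    rw [hU.frontier_eq] at hz
    exact hz.2 (h ▸ hp)
  obtain ⟨g₀, hg₀⟩ := exists_continuous_exp_eq_of_totallyDisconnected
    (⟨fun z : frontier U => (z : ℂ) - p, by fun_prop⟩ : C(frontier U, ℂ)) (fun z => hpU z z.2)
  obtain ⟨g, hg⟩ :=
    ContinuousMap.exists_extension' isClosed_frontier.isClosedEmbedding_subtypeVal g₀
  classical
  let F : ℂ → ℂ := U.piecewise (fun z => Complex.exp (g z)) (fun z => z - p)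
  have hF : Continuous F := by
    refine continuous_piecewise ?_ (by fun_prop) (by fun_prop)
    intro z hz
    have h1 : g z = g₀ ⟨z, hz⟩ := congrFun hg ⟨z, hz⟩
    rw [h1, hg₀]
    rfl
  have hF0 : ∀ z, F z ≠ 0 := by
    intro z
    by_cases hz : z ∈ U
    · simp [F, hz, Complex.exp_ne_zero]
    · simp only [F, Set.piecewise_eq_of_notMem _ _ _ hz]
      intro h
      exact hz (sub_eq_zero.1 h ▸ hp)
  have hsc : IsSimplyConnected (Set.univ : Set ℂ) := by
    have : ContractibleSpace (Set.univ : Set ℂ) :=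
      (convex_univ (𝕜 := ℝ)).contractibleSpace Set.univ_nonempty
    exact SimplyConnectedSpace.ofContractible _
  obtain ⟨L, hL, hLF⟩ := Complex.exists_continuousOn_eqOn_exp_comp (X := ℂ) (U := Set.univ)
    hsc isOpen_univ hF.continuousOn (by simpa using hF0)
  refine not_exists_continuous_exp_eq_sub (p := p) hr ⟨L, continuousOn_univ.1 hL, fun z hz => ?_⟩
  have hzU : z ∉ U := fun h => by
    have h1 := hUr h
    rw [Metric.mem_ball] at h1
    rw [Metric.mem_sphere] at hz
    linarith
  have := hLF (Set.mem_univ z)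
  simpa [F, hzU] using this

/-- The frontier of a bounded closed set containing a nondegenerate connected set contains a
nondegenerate connected set. -/
lemma exists_isPreconnected_subset_frontier {K S : Set ℂ} (hK : IsClosed K)
    (hb : Bornology.IsBounded K) (hSK : S ⊆ K) (hS : IsPreconnected S) (hnt : S.Nontrivial) :
    ∃ t ⊆ frontier K, IsPreconnected t ∧ ∃ x ∈ t, ∃ y ∈ t, x ≠ y := by
  rcases (interior K).eq_empty_or_nonempty with h | h
  · exact ⟨S, by rwa [hK.frontier_eq, h, Set.sdiff_empty], hS, hnt⟩
  · have := not_isTotallyDisconnected_frontier isOpen_interior h (hb.subset interior_subset)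
    unfold IsTotallyDisconnected at this
    push Not at this
    obtain ⟨t, ht, htc, htn⟩ := this
    exact ⟨t, ht.trans frontier_interior_subset, htc, htn⟩

section Winding

open Complex

lemma exp_half_log_re_pos {w : ℂ} (hw : w ∈ slitPlane) : 0 < (exp (log w / 2)).re := by
  rw [exp_re]
  refine mul_pos (Real.exp_pos _) (Real.cos_pos_of_mem_Ioo ?_)
  have h : (log w / 2).im = arg w / 2 := by
    rw [show (2 : ℂ) = ((2 : ℝ) : ℂ) by norm_num, div_ofReal_im, log_im]
  have h1 := neg_pi_lt_arg w
  have h2 := (arg_le_pi w).lt_of_ne (mem_slitPlane_iff_arg.1 hw).1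
  rw [h]
  constructor <;> linarith

lemma norm_one_sub_lt_norm_one_add {s : ℂ} (hs : 0 < s.re) : ‖1 - s‖ < ‖1 + s‖ := by
  rw [← sq_lt_sq₀ (norm_nonneg _) (norm_nonneg _), ← normSq_eq_norm_sq, ← normSq_eq_norm_sq,
    normSq_apply, normSq_apply]
  simp
  nlinarith

lemma one_sub_four_div_sq_mem_slitPlane {z : ℂ} (hz : z ∉ segment ℝ (-2 : ℂ) 2) :
    1 - 4 / z ^ 2 ∈ slitPlane := by
  by_contra ht
  rw [mem_slitPlane_iff] at ht
  push Not at ht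
  obtain ⟨a, ha, hat⟩ : ∃ a : ℝ, a ≤ 0 ∧ 1 - 4 / z ^ 2 = a :=
    ⟨_, ht.1, Complex.ext (by simp) (by simpa using ht.2)⟩
  have h0 : z ≠ 0 := by
    rintro rfl
    refine hz ((mem_segment_iff_div).2 ⟨1, 1, ?_⟩)
    norm_num
  have h1 : (1 - a) * z ^ 2 = 4 := by
    rw [← hat]; field_simp; ring
  have hs : (Real.sqrt (1 - a) : ℂ) ^ 2 = 1 - a := by
    rw [← ofReal_pow, Real.sq_sqrt (by linarith)]; push_cast; rfl
  set q := Real.sqrt (1 - a) with hq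
  have hq1 : 1 ≤ q := Real.one_le_sqrt.2 (by linarith)
  have h2 : ((q : ℂ) * z - 2) * (q * z + 2) = 0 := by
    linear_combination z ^ 2 * hs + h1
  have hq0 : (q : ℂ) ≠ 0 := by exact_mod_cast (by positivity : q ≠ 0)
  rw [segment_eq_image'] at hz
  have hqi : q⁻¹ ≤ 1 := inv_le_one_of_one_le₀ hq1
  have hqp : 0 < q⁻¹ := by positivity
  rcases mul_eq_zero.1 h2 with h | h
  · refine hz ⟨(1 + q⁻¹) / 2, ⟨by linarith, by linarith⟩, ?_⟩
    have : z = 2 / q := by field_simp; linear_combination h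
    rw [this]
    simp only [real_smul]
    push_cast
    field_simp
    ring
  · refine hz ⟨(1 - q⁻¹) / 2, ⟨by linarith, by linarith⟩, ?_⟩
    have : z = -2 / q := by field_simp; linear_combination h
    rw [this]
    simp only [real_smul]
    push_cast
    field_simp
    ring

lemma map_add_int {l : ℝ → ℂ} {d : ℂ} (h : ∀ t, l (t + 1) = l t + d) (t : ℝ) (n : ℤ) :
    l (t + n) = l t + n * d := by
  induction n with
  | zero => simp
  | succ n ih =>
    push_cast at ih ⊢
    rw [← add_assoc, h, ih]
    ring
  | pred n ih =>
    have := h (t + (-n - 1 : ℝ))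
    push_cast at ih ⊢
    rw [show t + (-n - 1 : ℝ) + 1 = t + -n by ring, ih] at this
    linear_combination -this

/-- `S` is the trace of a closed curve with a continuous logarithm about `c` that increases by
`2πi` over each period, that is, of a closed curve winding once around `c`. -/
def WindsOnce (c : ℂ) (S : Set ℂ) : Prop :=
  ∃ l : ℝ → ℂ, Continuous l ∧ (∀ t, l (t + 1) = l t + 2 * Real.pi * I) ∧
    Set.range (fun t => c + exp (l t)) = S

namespace WindsOnce

variable {c : ℂ} {S : Set ℂ}

lemma isPreconnected (h : WindsOnce c S) : IsPreconnected S := by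
  obtain ⟨l, hl, -, rfl⟩ := h
  exact isPreconnected_range (by fun_prop)

lemma circle (c : ℂ) {r : ℝ} (hr : 0 < r) : WindsOnce c {z | ‖z - c‖ = r} := by
  refine ⟨fun t => Real.log r + 2 * Real.pi * t * I, by fun_prop, fun t => by push_cast; ring, ?_⟩
  have hr' : (r : ℂ) ≠ 0 := by exact_mod_cast hr.ne'
  have key : ∀ t : ℝ, exp (Real.log r + 2 * Real.pi * t * I) =
      r * exp ((2 * Real.pi * t : ℝ) * I) := by
    intro t
    rw [exp_add, ofReal_log hr.le, exp_log hr']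
    push_cast
    rfl
  ext z
  simp only [Set.mem_range, key, Set.mem_ofPred_eq]
  constructor
  · rintro ⟨t, rfl⟩
    rw [add_sub_cancel_left, norm_mul, norm_exp_ofReal_mul_I]
    simp [abs_of_pos hr]
  · intro hz
    refine ⟨arg (z - c) / (2 * Real.pi), ?_⟩
    rw [mul_div_cancel₀ _ (by positivity), ← hz, norm_mul_exp_arg_mul_I]
    ring

lemma image_affine (h : WindsOnce c S) {k : ℂ} (hk : k ≠ 0) (d : ℂ) :
    WindsOnce (k * c + d) ((fun z => k * z + d) '' S) := by
  obtain ⟨l, hl, hper, rfl⟩ := h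
  refine ⟨fun t => log k + l t, by fun_prop, fun t => by simp only [hper]; ring, ?_⟩
  rw [← Set.range_comp]
  congr 1
  ext t
  simp only [Function.comp, exp_add, exp_log hk]
  ring

lemma change_center {x y : ℂ} (h : WindsOnce x S) (hS : Disjoint S (segment ℝ x y)) :
    WindsOnce y S := by
  obtain ⟨l, hl, hper, rfl⟩ := h
  have hslit : ∀ t, 1 - (y - x) / exp (l t) ∈ slitPlane := by
    intro t
    by_contra ht
    have hle : ∃ a : ℝ, a ≤ 0 ∧ 1 - (y - x) / exp (l t) = a := by
      rw [mem_slitPlane_iff] at ht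
      push Not at ht
      exact ⟨_, ht.1, Complex.ext (by simp) (by simpa using ht.2)⟩
    obtain ⟨a, ha, hat⟩ := hle
    have hE := exp_ne_zero (l t)
    have h2 : (1 - (a : ℂ)) * exp (l t) = y - x := by
      rw [← hat]; field_simp; ring
    refine Set.disjoint_left.1 hS ⟨t, rfl⟩ ?_
    rw [segment_eq_image']
    have ha1 : (1 - a) ≠ 0 := by linarith
    have ha1' : (1 - (a : ℂ)) ≠ 0 := by exact_mod_cast ha1
    refine ⟨(1 - a)⁻¹, ⟨inv_nonneg.2 (by linarith), ?_⟩, ?_⟩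
    · exact inv_le_one_of_one_le₀ (by linarith)
    · simp only [real_smul]
      push_cast
      rw [← h2]
      field_simp
  refine ⟨fun t => l t + log (1 - (y - x) / exp (l t)), ?_, fun t => ?_, ?_⟩
  · refine hl.add (Continuous.clog ?_ hslit)
    exact continuous_const.sub (continuous_const.div (by fun_prop) fun t => exp_ne_zero _)
  · simp only [hper, exp_add, exp_two_pi_mul_I, mul_one]
    ring
  · congr 1
    ext t
    have hE := exp_ne_zero (l t)
    rw [exp_add, exp_log (slitPlane_ne_zero (hslit t))]
    field_simp
    ring

/-- A loop around `[-2, 2]` lifts through the Joukowski map `u ↦ u + u⁻¹` to a loop outside the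
closed unit disc. -/
lemma exists_joukowski_lift (h : WindsOnce 0 S) (hS : Disjoint S (segment ℝ (-2 : ℂ) 2)) :
    ∃ l : ℝ → ℂ, Continuous l ∧ (∀ t, l (t + 1) = l t + 2 * Real.pi * I) ∧
      (∀ t, 0 < (l t).re) ∧ Set.range (fun t => exp (l t) + exp (-l t)) = S := by
  obtain ⟨l, hl, hper, rfl⟩ := h
  simp only [zero_add] at hS ⊢
  have hslit : ∀ t, 1 - 4 / exp (l t) ^ 2 ∈ slitPlane := fun t =>
    one_sub_four_div_sq_mem_slitPlane (Set.disjoint_left.1 hS ⟨t, rfl⟩)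
  let s : ℝ → ℂ := fun t => exp (log (1 - 4 / exp (l t) ^ 2) / 2)
  have hs_re : ∀ t, 0 < (s t).re := fun t => exp_half_log_re_pos (hslit t)
  have hs_sq : ∀ t, s t ^ 2 = 1 - 4 / exp (l t) ^ 2 := fun t => by
    simp only [s]
    rw [← exp_nat_mul, Nat.cast_ofNat, mul_div_cancel₀ _ (two_ne_zero),
      exp_log (slitPlane_ne_zero (hslit t))]
  have hs_cont : Continuous s := by
    have : Continuous fun t => log (1 - 4 / exp (l t) ^ 2) := by
      refine Continuous.clog ?_ hslit
      exact continuous_const.sub (continuous_const.div (by fun_prop)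
        fun t => pow_ne_zero _ (exp_ne_zero _))
    fun_prop
  have hs_per : ∀ t, s (t + 1) = s t := fun t => by
    simp only [s, hper, exp_add, exp_two_pi_mul_I, mul_one]
  have hslit' : ∀ t, (1 + s t) / 2 ∈ slitPlane := fun t => by
    refine Or.inl ?_
    have : ((1 + s t) / 2).re = (1 + (s t).re) / 2 := by
      rw [show (2 : ℂ) = ((2 : ℝ) : ℂ) by norm_num, div_ofReal_re]; simp
    rw [this]
    linarith [hs_re t]
  have hexp : ∀ t, exp (l t + log ((1 + s t) / 2)) = exp (l t) * (1 + s t) / 2 := fun t => by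
    rw [exp_add, exp_log (slitPlane_ne_zero (hslit' t)), mul_div_assoc]
  have hexp_neg : ∀ t, exp (-(l t + log ((1 + s t) / 2))) = exp (l t) * (1 - s t) / 2 :=
    fun t => by
    have hE := exp_ne_zero (l t)
    have h1 : 1 + s t ≠ 0 := fun h => slitPlane_ne_zero (hslit' t) (by rw [h, zero_div])
    have h2 := hs_sq t
    rw [exp_neg, hexp, inv_eq_iff_eq_inv, eq_comm, inv_eq_iff_eq_inv, eq_comm, ← one_div,
      div_eq_iff (by simp [hE, h1])]
    field_simp at h2
    linear_combination (1 / 4 : ℂ) * h2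
  refine ⟨fun t => l t + log ((1 + s t) / 2), hl.add (Continuous.clog (by fun_prop) hslit'),
    fun t => by simp only [hper, hs_per]; ring, fun t => ?_, ?_⟩
  · have h1 : ‖exp (-(l t + log ((1 + s t) / 2)))‖ < ‖exp (l t + log ((1 + s t) / 2))‖ := by
      rw [hexp, hexp_neg, norm_div, norm_div, norm_mul, norm_mul]
      have := norm_one_sub_lt_norm_one_add (hs_re t)
      have := norm_pos_iff.2 (exp_ne_zero (l t))
      have : (0 : ℝ) < ‖(2 : ℂ)‖ := by simp
      gcongr
    rw [norm_exp, norm_exp, Real.exp_lt_exp, neg_re] at h1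
    linarith
  · congr 1
    ext t
    rw [hexp, hexp_neg]
    ring

lemma preimage_cubic (h : WindsOnce 0 S) (hS : Disjoint S (segment ℝ (-2 : ℂ) 2)) :
    WindsOnce 0 ((fun z => z ^ 3 - 3 * z) ⁻¹' S) := by
  obtain ⟨l, hl, hper, hre, rfl⟩ := h.exists_joukowski_lift hS
  let v : ℝ → ℂ := fun t => l (3 * t) / 3
  have hv_re : ∀ t, 0 < (v t).re := fun t => by
    simp only [v]
    rw [show (3 : ℂ) = ((3 : ℝ) : ℂ) by norm_num, div_ofReal_re]
    have := hre (3 * t)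
    positivity
  have hv_per : ∀ t, v (t + 1) = v t + 2 * Real.pi * I := fun t => by
    have := map_add_int hper (3 * t) 3
    simp only [v]
    push_cast at this
    rw [mul_add, mul_one, this]
    ring
  have hslit : ∀ t, 1 + exp (-(2 * v t)) ∈ slitPlane := fun t => by
    refine Or.inl ?_
    have h1 : ‖exp (-(2 * v t))‖ < 1 := by
      rw [norm_exp, Real.exp_lt_one_iff]
      have := hv_re t
      simp
      linarith
    have h2 := (abs_re_le_norm _).trans_lt h1
    rw [abs_lt] at h2
    rw [add_re, one_re]
    linarith
  have hcurve : ∀ t, 0 + exp (v t + log (1 + exp (-(2 * v t)))) = exp (v t) + exp (-v t) :=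
    fun t => by
    rw [exp_add, exp_log (slitPlane_ne_zero (hslit t)), mul_add, ← exp_add]
    ring_nf
  have hcubic : ∀ y : ℂ, (exp y + exp (-y)) ^ 3 - 3 * (exp y + exp (-y)) =
      exp (3 * y) + exp (-(3 * y)) := fun y => by
    have h1 : exp y * exp (-y) = 1 := by rw [← exp_add]; simp
    have h2 : exp (3 * y) = exp y ^ 3 := by rw [← exp_nat_mul]; norm_num
    have h3 : exp (-(3 * y)) = exp (-y) ^ 3 := by rw [← exp_nat_mul]; congr 1; push_cast; ring
    rw [h2, h3]
    linear_combination (3 * (exp y + exp (-y))) * h1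
  have hv_cont : Continuous v := by fun_prop
  refine ⟨fun t => v t + log (1 + exp (-(2 * v t))), hv_cont.add (Continuous.clog (by fun_prop)
    hslit), fun t => ?_, ?_⟩
  · have : exp (-(2 * (v t + 2 * Real.pi * I))) = exp (-(2 * v t)) := by
      rw [exp_eq_exp_iff_exists_int]
      exact ⟨-2, by push_cast; ring⟩
    simp only [hv_per, this]
    ring
  · simp only [hcurve]
    ext z
    simp only [Set.mem_range, Set.mem_preimage]
    constructor
    · rintro ⟨t, rfl⟩
      refine ⟨3 * t, ?_⟩
      rw [hcubic]
      simp only [v]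
      rw [mul_div_cancel₀ _ (by norm_num)]
    · rintro ⟨t, ht⟩
      have key : ∀ y : ℂ, z = exp y + exp (-y) → exp (3 * y) = exp (l t) →
          ∃ t, exp (v t) + exp (-v t) = z := by
        rintro y rfl hy
        obtain ⟨n, hn⟩ := exp_eq_exp_iff_exists_int.1 hy
        refine ⟨(t + n) / 3, ?_⟩
        have : v ((t + n) / 3) = y := by
          simp only [v]
          rw [mul_div_cancel₀ _ (by norm_num), map_add_int hper, ← hn]
          ring
        rw [this]
      obtain ⟨q, hq⟩ := IsAlgClosed.exists_pow_nat_eq (z ^ 2 - 4) (n := 2) (by norm_num)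
      have hx : (z + q) / 2 ≠ 0 := by
        intro h
        have : q = -z := by linear_combination 2 * h
        rw [this] at hq
        have h4 : (4 : ℂ) = 0 := by linear_combination hq
        norm_num at h4
      obtain ⟨y, hy⟩ : ∃ y, exp y = (z + q) / 2 := ⟨_, exp_log hx⟩
      have hy' : exp (-y) = (z - q) / 2 := by
        rw [exp_neg, hy, inv_eq_one_div, div_eq_iff hx]
        linear_combination (1 / 4 : ℂ) * hq
      have hz : z = exp y + exp (-y) := by rw [hy, hy']; ring
      rw [hz, hcubic] at ht
      have h1 : exp (3 * y) * exp (-(3 * y)) = 1 := by rw [← exp_add]; simp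
      have h2 : exp (l t) * exp (-(l t)) = 1 := by rw [← exp_add]; simp
      have h3 : (exp (3 * y) - exp (l t)) * (exp (-(3 * y)) - exp (l t)) = 0 := by
        linear_combination h1 - h2 + exp (l t) * ht
      rcases mul_eq_zero.1 h3 with h | h
      · exact key y hz (sub_eq_zero.1 h)
      · refine key (-y) (by rw [neg_neg, add_comm]; exact hz) ?_
        rw [mul_neg]
        exact sub_eq_zero.1 h

/-- The preimage of a loop around the critical values of a cubic polynomial is a loop around the
centre of the critical points. -/
lemma preimage_of_eq_cubic (h : WindsOnce c S) {f : ℂ → ℂ} {a k m : ℂ} (ha : a ≠ 0) (hk : k ≠ 0)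
    (hf : ∀ z, f (k * z + m) = a * (z ^ 3 - 3 * z) + c)
    (hS : Disjoint S (segment ℝ (c - 2 * a) (c + 2 * a))) : WindsOnce m (f ⁻¹' S) := by
  have h1 := h.image_affine (inv_ne_zero ha) (-(a⁻¹ * c))
  rw [add_neg_cancel] at h1
  have h2 := (h1.preimage_cubic ?_).image_affine hk m
  · rw [mul_zero, zero_add] at h2
    convert h2
    ext z
    simp only [Set.mem_preimage, Set.mem_image]
    constructor
    · intro hz
      refine ⟨(z - m) / k, ⟨f z, hz, ?_⟩, by field_simp; ring⟩
      have := hf ((z - m) / k)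
      rw [mul_div_cancel₀ _ hk, sub_add_cancel] at this
      rw [this]
      field_simp
      ring
    · rintro ⟨x, ⟨y, hy, hyx⟩, rfl⟩
      rw [hf, ← hyx]
      convert hy using 1
      field_simp
      ring
  · rw [Set.disjoint_left]
    rintro _ ⟨y, hy, rfl⟩ hseg
    rw [segment_eq_image'] at hseg
    obtain ⟨θ, hθ, hθy⟩ := hseg
    refine Set.disjoint_left.1 hS hy ?_
    rw [segment_eq_image']
    refine ⟨θ, hθ, ?_⟩
    simp only [real_smul] at hθy ⊢
    field_simp at hθy
    linear_combination hθy

end WindsOnce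

end Winding

lemma segment_ofReal_subset {x y α β : ℝ} (hx : x ∈ Set.Icc α β) (hy : y ∈ Set.Icc α β) :
    segment ℝ (x : ℂ) y ⊆ Complex.ofReal '' Set.Icc α β :=
  ((convex_Icc α β).is_linear_image Complex.ofRealCLM.isLinear).segment_subset
    ⟨x, hx, rfl⟩ ⟨y, hy, rfl⟩

/-- The normal form, up to affine conjugacy, of the polynomials under consideration. The fixed
points are `-2`, `0` and `b`, and `0` has multiplier `-1`. -/
noncomputable def cubic {K : Type*} [Field K] (b z : K) : K :=
  z ^ 3 / b - (1 - 2 / b) * z ^ 2 - z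

lemma ofReal_cubic (b x : ℝ) : ((cubic b x : ℝ) : ℂ) = cubic (b : ℂ) x := by
  simp [cubic]

lemma iterate_cubic_ofReal (b x : ℝ) (n : ℕ) :
    (cubic (b : ℂ))^[n] (x : ℂ) = ((cubic b)^[n] x : ℝ) := by
  induction n with
  | zero => rfl
  | succ n ih => rw [Function.iterate_succ_apply', Function.iterate_succ_apply', ih, ofReal_cubic]

lemma continuous_cubic (b : ℂ) : Continuous (cubic b) := by
  unfold cubic
  fun_prop

section Cubic

variable {b : ℝ}

lemma cubic_add_two (hb : b ≠ 0) (x : ℝ) :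
    cubic b x + 2 = (x + 2) * ((x ^ 2 - b * x + b) / b) := by
  unfold cubic
  field_simp
  ring

lemma cubic_sub_self (hb : b ≠ 0) (x : ℝ) :
    cubic b x - b = (x - b) * ((x ^ 2 + 2 * x + b) / b) := by
  unfold cubic
  field_simp
  ring

lemma two_mul_norm_le_norm_cubic (hb : 1 ≤ b) (z : ℂ) (hz : 10 * b ≤ ‖z‖) :
    2 * ‖z‖ ≤ ‖cubic (b : ℂ) z‖ := by
  have hb0 : (b : ℂ) ≠ 0 := by exact_mod_cast (by positivity : b ≠ 0)
  have h : cubic (b : ℂ) z = z * (z * (z - (b - 2 : ℝ)) - b) / b := by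
    unfold cubic
    push_cast
    field_simp
  have h1 : ‖z‖ - (b + 2) ≤ ‖z - (b - 2 : ℝ)‖ := by
    have h2 := norm_sub_norm_le z ((b - 2 : ℝ) : ℂ)
    have h3 : ‖((b - 2 : ℝ) : ℂ)‖ ≤ b + 2 := by
      rw [Complex.norm_real, Real.norm_eq_abs, abs_le]
      constructor <;> linarith
    linarith
  have h4 : ‖z‖ * (‖z‖ - (b + 2)) - b ≤ ‖z * (z - (b - 2 : ℝ)) - b‖ := by
    have h2 := norm_sub_norm_le (z * (z - (b - 2 : ℝ))) (b : ℂ)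
    rw [norm_mul, Complex.norm_real, Real.norm_eq_abs, abs_of_nonneg (by linarith)] at h2
    have := mul_le_mul_of_nonneg_left h1 (norm_nonneg z)
    linarith
  rw [h, norm_div, norm_mul, Complex.norm_real, Real.norm_eq_abs, abs_of_nonneg (by linarith),
    le_div_iff₀ (by linarith)]
  have h5 : 2 * b ≤ ‖z * (z - (b - 2 : ℝ)) - b‖ := by
    refine le_trans ?_ h4
    nlinarith
  nlinarith [norm_nonneg z]

lemma image_Icc_subset_filledJulia {α β : ℝ}
    (h : Set.MapsTo (cubic b) (Set.Icc α β) (Set.Icc α β)) :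
    Complex.ofReal '' Set.Icc α β ⊆ filledJulia (cubic (b : ℂ)) := by
  rintro _ ⟨x, hx, rfl⟩
  rw [mem_filledJulia]
  refine ((isCompact_Icc (a := α) (b := β)).image Complex.continuous_ofReal).isBounded.subset ?_
  rintro _ ⟨n, rfl⟩
  exact ⟨_, h.iterate n hx, (iterate_cubic_ofReal b x n).symm⟩

lemma mapsTo_cubic_Icc_fixedPoints (hb : 1 ≤ b) (hb' : b ≤ 4) :
    Set.MapsTo (cubic b) (Set.Icc (-2) b) (Set.Icc (-2) b) := by
  rintro x ⟨hx1, hx2⟩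
  have hb0 : 0 < b := by linarith
  have h1 : 0 ≤ (x ^ 2 - b * x + b) / b := by
    refine div_nonneg ?_ hb0.le
    nlinarith [sq_nonneg (x - b / 2)]
  have h2 : 0 ≤ (x ^ 2 + 2 * x + b) / b := by
    refine div_nonneg ?_ hb0.le
    nlinarith [sq_nonneg (x + 1)]
  have h3 := cubic_add_two hb0.ne' x
  have h4 := cubic_sub_self hb0.ne' x
  constructor <;> nlinarith

lemma mapsTo_cubic_Icc_neg_two_one (hb : 4 ≤ b) :
    Set.MapsTo (cubic b) (Set.Icc (-2) 1) (Set.Icc (-2) 1) := by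
  rintro x ⟨hx1, hx2⟩
  have hb0 : 0 < b := by linarith
  have h1 : 0 ≤ (x ^ 2 - b * x + b) / b := by
    refine div_nonneg ?_ hb0.le
    nlinarith [sq_nonneg x]
  have h3 := cubic_add_two hb0.ne' x
  refine ⟨by nlinarith, ?_⟩
  have h5 : cubic b x = -x - x ^ 2 + x ^ 2 * (x + 2) / b := by
    unfold cubic
    field_simp
    ring
  have h6 : x ^ 2 * (x + 2) / b ≤ x ^ 2 * (x + 2) / 4 := by
    have : 0 ≤ x ^ 2 * (x + 2) := mul_nonneg (sq_nonneg x) (by linarith)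
    gcongr
  rw [h5]
  nlinarith [sq_nonneg (x + 1), sq_nonneg x, mul_nonneg (sq_nonneg x) (sub_nonneg.2 hx2)]

/-- The distance of the critical points of `cubic b` to their centre `(b - 2) / 3`. -/
noncomputable def critRadius (b : ℝ) : ℝ := Real.sqrt (b ^ 2 - b + 4) / 3

lemma critRadius_pos (b : ℝ) : 0 < critRadius b := by
  have : 0 < b ^ 2 - b + 4 := by nlinarith [sq_nonneg (b - 1 / 2)]
  unfold critRadius
  positivity

lemma critRadius_sq (b : ℝ) : 9 * critRadius b ^ 2 = b ^ 2 - b + 4 := by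
  unfold critRadius
  rw [div_pow, Real.sq_sqrt (by nlinarith [sq_nonneg (b - 1 / 2)])]
  ring

lemma cubic_affine {K : Type*} [Field K] [CharZero K] {b k : K} (hb : b ≠ 0)
    (hk : 9 * k ^ 2 = b ^ 2 - b + 4) (z : K) :
    cubic b (k * z + (b - 2) / 3) =
      k ^ 3 / b * (z ^ 3 - 3 * z) + cubic b ((b - 2) / 3) := by
  unfold cubic
  field_simp
  linear_combination (9 * k * z) * hk

lemma windsOnce_level_cubic (hb : 1 ≤ b) (hb' : b ≤ 4) (n : ℕ) :
    WindsOnce (((b - 2) / 3 : ℝ) : ℂ) {z | ‖(cubic (b : ℂ))^[n] z‖ = 10 * b} := by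
  have hb0 : 0 < b := by linarith
  have hbC : (b : ℂ) ≠ 0 := by exact_mod_cast hb0.ne'
  have hmaps := mapsTo_cubic_Icc_fixedPoints hb hb'
  have hdisj : ∀ n, Disjoint {z | ‖(cubic (b : ℂ))^[n] z‖ = 10 * b}
      (Complex.ofReal '' Set.Icc (-2) b) := fun n => Set.disjoint_left.2 fun z hz hzI =>
    ((mem_filledJulia_iff (by positivity) (two_mul_norm_le_norm_cubic hb)).1
      (image_Icc_subset_filledJulia hmaps hzI) n).ne hz
  have hm : (b - 2) / 3 ∈ Set.Icc (-2) b := ⟨by linarith, by linarith⟩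
  induction n with
  | zero =>
    have h := WindsOnce.circle 0 (r := 10 * b) (by positivity)
    simp only [sub_zero] at h
    refine h.change_center ((hdisj 0).mono_right ?_)
    exact_mod_cast segment_ofReal_subset ⟨by norm_num, hb0.le⟩ hm
  | succ n ih =>
    have hk := critRadius_pos b
    have hk2 := critRadius_sq b
    set k := critRadius b
    have hkC : (k : ℂ) ≠ 0 := by exact_mod_cast hk.ne'
    have h1 := ih.change_center ((hdisj n).mono_right (segment_ofReal_subset hm (hmaps hm)))
    refine h1.preimage_of_eq_cubic (f := cubic (b : ℂ)) (a := ((k ^ 3 / b : ℝ) : ℂ)) (k := k)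
      (by exact_mod_cast (by positivity : k ^ 3 / b ≠ 0)) hkC (fun z => ?_)
      ((hdisj n).mono_right ?_)
    · rw [ofReal_cubic]
      push_cast
      exact cubic_affine hbC (by exact_mod_cast hk2) z
    · have hp := cubic_affine hb0.ne' hk2 1
      have hm' := cubic_affine hb0.ne' hk2 (-1)
      have hkp : k * 1 + (b - 2) / 3 ∈ Set.Icc (-2) b := by
        constructor <;> nlinarith
      have hkm : k * -1 + (b - 2) / 3 ∈ Set.Icc (-2) b := by
        constructor <;> nlinarith
      have hp' := hmaps hkp
      have hm'' := hmaps hkm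
      rw [hp, show ∀ a c : ℝ, a * (1 ^ 3 - 3 * 1) + c = c - 2 * a by intros; ring] at hp'
      rw [hm', show ∀ a c : ℝ, a * ((-1) ^ 3 - 3 * -1) + c = c + 2 * a by intros; ring] at hm''
      simpa only [Complex.ofReal_add, Complex.ofReal_sub, Complex.ofReal_mul,
        Complex.ofReal_ofNat] using segment_ofReal_subset hp' hm''

lemma isConnected_frontier_filledJulia_cubic (hb : 1 ≤ b) (hb' : b ≤ 4) :
    IsConnected (frontier (filledJulia (cubic (b : ℂ)))) := by
  have hesc := two_mul_norm_le_norm_cubic hb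
  have hb0 : 0 < 10 * b := by linarith
  refine ⟨frontier_filledJulia_nonempty hb0 hesc ⟨_, image_Icc_subset_filledJulia
    (mapsTo_cubic_Icc_fixedPoints hb hb') ⟨b, ⟨by linarith, le_rfl⟩, rfl⟩⟩,
    isPreconnected_frontier_filledJulia (continuous_cubic _) hb0 hesc fun n =>
      (windsOnce_level_cubic hb hb' n).isPreconnected⟩

lemma notMem_filledJulia_of_lt_neg_two (hb : 0 < b) {x : ℝ} (hx : x < -2) :
    (x : ℂ) ∉ filledJulia (cubic (b : ℂ)) := by
  have hstep : ∀ y : ℝ, y < -2 → cubic b y + 2 ≤ 2 * (y + 2) := by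
    intro y hy
    rw [cubic_add_two hb.ne']
    have : 2 ≤ (y ^ 2 - b * y + b) / b := by
      rw [le_div_iff₀ hb]
      nlinarith
    nlinarith
  have hiter : ∀ n, (cubic b)^[n] x + 2 ≤ 2 ^ n * (x + 2) := by
    intro n
    induction n with
    | zero => simp
    | succ n ih =>
      have h1 : (0 : ℝ) < 2 ^ n := by positivity
      rw [Function.iterate_succ_apply', pow_succ]
      have := hstep ((cubic b)^[n] x) (by nlinarith)
      linarith
  rw [mem_filledJulia]
  intro hbd
  obtain ⟨C, hC⟩ := hbd.exists_norm_le
  obtain ⟨n, hn⟩ := pow_unbounded_of_one_lt (C / (-2 - x)) (one_lt_two : (1 : ℝ) < 2)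
  have h1 := hC _ ⟨n, rfl⟩
  simp only [iterate_cubic_ofReal, Complex.norm_real, Real.norm_eq_abs] at h1
  rw [div_lt_iff₀ (by linarith)] at hn
  have h2 := hiter n
  have h3 := neg_abs_le ((cubic b)^[n] x)
  linarith

lemma notMem_filledJulia_of_lt (hb : 1 ≤ b) {x : ℝ} (hx : b < x) :
    (x : ℂ) ∉ filledJulia (cubic (b : ℂ)) := by
  have hb0 : 0 < b := by linarith
  have hstep : ∀ y : ℝ, b < y → 2 * (y - b) ≤ cubic b y - b := by
    intro y hy
    rw [cubic_sub_self hb0.ne']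
    have : 2 ≤ (y ^ 2 + 2 * y + b) / b := by
      rw [le_div_iff₀ hb0]
      nlinarith
    nlinarith
  have hiter : ∀ n, 2 ^ n * (x - b) ≤ (cubic b)^[n] x - b := by
    intro n
    induction n with
    | zero => simp
    | succ n ih =>
      have h1 : (0 : ℝ) < 2 ^ n := by positivity
      rw [Function.iterate_succ_apply', pow_succ]
      have := hstep ((cubic b)^[n] x) (by nlinarith)
      linarith
  rw [mem_filledJulia]
  intro hbd
  obtain ⟨C, hC⟩ := hbd.exists_norm_le
  obtain ⟨n, hn⟩ := pow_unbounded_of_one_lt (C / (x - b)) (one_lt_two : (1 : ℝ) < 2)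
  have h1 := hC _ ⟨n, rfl⟩
  simp only [iterate_cubic_ofReal, Complex.norm_real, Real.norm_eq_abs] at h1
  rw [div_lt_iff₀ (by linarith)] at hn
  have h2 := hiter n
  have h3 := le_abs_self ((cubic b)^[n] x)
  linarith

lemma ofReal_mem_filledJulia_of_fixed {x : ℝ} (hx : cubic b x = x) :
    (x : ℂ) ∈ filledJulia (cubic (b : ℂ)) := by
  refine image_Icc_subset_filledJulia (α := x) (β := x) ?_ ⟨x, by simp, rfl⟩
  rw [Set.Icc_self]
  rintro _ rfl
  exact hx

lemma neg_two_mem_frontier (hb : 0 < b) :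
    ((-2 : ℝ) : ℂ) ∈ frontier (filledJulia (cubic (b : ℂ))) := by
  rw [frontier_eq_closure_inter_closure]
  refine ⟨subset_closure (ofReal_mem_filledJulia_of_fixed ?_), ?_⟩
  · have := cubic_add_two hb.ne' (-2)
    linarith
  · have h : (-2 : ℝ) ∈ closure (Set.Iio (-2 : ℝ)) := by simp
    refine closure_mono ?_ (image_closure_subset_closure_image Complex.continuous_ofReal
      ⟨_, h, rfl⟩)
    rintro _ ⟨x, hx, rfl⟩
    exact notMem_filledJulia_of_lt_neg_two hb hx

lemma right_fixedPoint_mem_frontier (hb : 1 ≤ b) :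
    (b : ℂ) ∈ frontier (filledJulia (cubic (b : ℂ))) := by
  rw [frontier_eq_closure_inter_closure]
  refine ⟨subset_closure (ofReal_mem_filledJulia_of_fixed ?_), ?_⟩
  · have := cubic_sub_self (by linarith : b ≠ 0) b
    linarith
  · have h : b ∈ closure (Set.Ioi b) := by simp
    refine closure_mono ?_ (image_closure_subset_closure_image Complex.continuous_ofReal
      ⟨_, h, rfl⟩)
    rintro _ ⟨x, hx, rfl⟩
    exact notMem_filledJulia_of_lt hb hx

lemma cubic_critPoint_lt_neg_two (hb : 5 ≤ b) :
    cubic b (critRadius b + (b - 2) / 3) < -2 := by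
  have hb0 : 0 < b := by linarith
  have hk := critRadius_pos b
  have hk2 := critRadius_sq b
  set k := critRadius b
  have h := cubic_add_two hb0.ne' (k + (b - 2) / 3)
  have hk3 : b - 1 / 2 < 3 * k := by nlinarith
  have hneg : ((k + (b - 2) / 3) ^ 2 - b * (k + (b - 2) / 3) + b) / b < 0 := by
    refine div_neg_of_neg_of_pos ?_ hb0
    nlinarith
  nlinarith

/-- The branch of the hyperbola through the escaping critical point, on which `cubic b` is real,
misses the filled-in Julia set. -/
lemma notMem_filledJulia_of_hyperbola (hb : 5 ≤ b) {z : ℂ}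
    (hz : z.re = Real.sqrt (1 + z.im ^ 2 / 3)) :
    critRadius b * z + ((b - 2) / 3 : ℝ) ∉ filledJulia (cubic (b : ℂ)) := by
  have hb0 : 0 < b := by linarith
  have hbC : (b : ℂ) ≠ 0 := by exact_mod_cast hb0.ne'
  have hk := critRadius_pos b
  have hk2 := critRadius_sq b
  have hcrit := cubic_critPoint_lt_neg_two hb
  set k := critRadius b
  have hre : 1 ≤ z.re := by
    rw [hz]
    exact Real.one_le_sqrt.2 (by linarith [sq_nonneg z.im])
  have him : z.im ^ 2 = 3 * z.re ^ 2 - 3 := by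
    rw [hz, Real.sq_sqrt (by positivity)]
    ring
  have hT : z ^ 3 - 3 * z = ((-8 * z.re ^ 3 + 6 * z.re : ℝ) : ℂ) := by
    apply Complex.ext
    · simp only [pow_succ, pow_zero, one_mul, Complex.sub_re, Complex.mul_re, Complex.mul_im,
        Complex.ofReal_re, Complex.re_ofNat, Complex.im_ofNat]
      linear_combination (-3 * z.re) * him
    · simp only [pow_succ, pow_zero, one_mul, Complex.sub_im, Complex.mul_re, Complex.mul_im,
        Complex.ofReal_im, Complex.re_ofNat, Complex.im_ofNat]
      linear_combination (-z.im) * him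
  have hval : cubic (b : ℂ) (k * z + ((b - 2) / 3 : ℝ)) =
      ((k ^ 3 / b * (-8 * z.re ^ 3 + 6 * z.re) + cubic b ((b - 2) / 3) : ℝ) : ℂ) := by
    have := cubic_affine hbC (k := (k : ℂ)) (by exact_mod_cast hk2) z
    rw [hT] at this
    push_cast [ofReal_cubic] at this ⊢
    exact this
  have hlt : k ^ 3 / b * (-8 * z.re ^ 3 + 6 * z.re) + cubic b ((b - 2) / 3) < -2 := by
    have h1 := cubic_affine hb0.ne' hk2 1
    rw [mul_one] at h1
    rw [h1] at hcrit
    have h2 : 0 < k ^ 3 / b := by positivity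
    have h3 : -8 * z.re ^ 3 + 6 * z.re ≤ 1 ^ 3 - 3 * 1 := by
      nlinarith [mul_nonneg (sub_nonneg.2 hre) (sq_nonneg z.re)]
    have := mul_le_mul_of_nonneg_left h3 h2.le
    linarith
  intro hmem
  refine notMem_filledJulia_of_lt_neg_two hb0 hlt ?_
  rw [← hval, mem_filledJulia]
  refine (mem_filledJulia.1 hmem).subset ?_
  rintro _ ⟨n, rfl⟩
  exact ⟨n + 1, rfl⟩

lemma not_isPreconnected_frontier_filledJulia_cubic (hb : 5 ≤ b) :
    ¬ IsPreconnected (frontier (filledJulia (cubic (b : ℂ)))) := by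
  intro hpre
  have hb0 : 0 < b := by linarith
  have hk := critRadius_pos b
  have hk2 := critRadius_sq b
  have hkC : (critRadius b : ℂ) ≠ 0 := by exact_mod_cast hk.ne'
  let g : ℂ → ℂ := fun z => (z - ((b - 2) / 3 : ℝ)) / critRadius b
  have hg : ∀ x : ℝ, g x = ((x - (b - 2) / 3) / critRadius b : ℝ) := fun x => by
    simp only [g]; push_cast; rfl
  have hcont : Continuous fun z => (g z).re - Real.sqrt (1 + (g z).im ^ 2 / 3) := by
    have : Continuous g := by fun_prop
    fun_prop
  obtain ⟨z, hzJ, hz⟩ := hpre.intermediate_value (neg_two_mem_frontier hb0)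
    (right_fixedPoint_mem_frontier (by linarith)) hcont.continuousOn
    (show (0 : ℝ) ∈ Set.Icc _ _ by
      simp only [hg, Complex.ofReal_re, Complex.ofReal_im]
      norm_num
      constructor
      · refine (div_nonpos_of_nonpos_of_nonneg ?_ hk.le).trans zero_le_one
        linarith
      · rw [le_div_iff₀ hk]
        nlinarith)
  have hesc := two_mul_norm_le_norm_cubic (by linarith : 1 ≤ b)
  refine notMem_filledJulia_of_hyperbola hb (z := g z) (sub_eq_zero.1 hz) ?_
  have hgz : critRadius b * g z + ((b - 2) / 3 : ℝ) = z := by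
    simp only [g]
    field_simp
    ring
  rw [hgz]
  exact (isClosed_filledJulia (continuous_cubic _) (by positivity) hesc).frontier_subset hzJ

lemma exists_isPreconnected_subset_frontier_cubic (hb : 4 ≤ b) :
    ∃ t ⊆ frontier (filledJulia (cubic (b : ℂ))), IsPreconnected t ∧ ∃ x ∈ t, ∃ y ∈ t, x ≠ y := by
  have hesc := two_mul_norm_le_norm_cubic (by linarith : 1 ≤ b)
  have hb0 : 0 < 10 * b := by linarith
  refine exists_isPreconnected_subset_frontier (isClosed_filledJulia (continuous_cubic _) hb0 hesc)
    (isBounded_filledJulia hb0 hesc)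
    (image_Icc_subset_filledJulia (mapsTo_cubic_Icc_neg_two_one hb))
    (isPreconnected_Icc.image _ Complex.continuous_ofReal.continuousOn)
    ⟨(0 : ℝ), ⟨0, by norm_num, rfl⟩, (1 : ℝ), ⟨1, by norm_num, rfl⟩, by norm_num⟩

end Cubic

lemma filledJulia_eq_image_of_semiconj {f g : ℂ → ℂ} {k d : ℂ} (hk : k ≠ 0)
    (h : ∀ z, g (k * z + d) = k * f z + d) :
    filledJulia g = (affineHomeomorph k d hk) '' filledJulia f := by
  have hs : Function.Semiconj (affineHomeomorph k d hk) f g := fun z => (h z).symm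
  have hlip : LipschitzWith ‖k‖₊ (affineHomeomorph k d hk) :=
    LipschitzWith.of_dist_le_mul fun x y => by
      simp [dist_eq_norm, ← mul_sub]
  have hlip' : LipschitzWith ‖k⁻¹‖₊ (affineHomeomorph k d hk).symm :=
    LipschitzWith.of_dist_le_mul fun x y => by
      simp only [dist_eq_norm, affineHomeomorph_symm_apply, div_eq_inv_mul, ← mul_sub, norm_mul,
        sub_sub_sub_cancel_right, coe_nnnorm, le_refl]
  ext z
  obtain ⟨w, rfl⟩ := (affineHomeomorph k d hk).surjective z
  rw [(affineHomeomorph k d hk).injective.mem_set_image, mem_filledJulia, mem_filledJulia]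
  have hrange : (Set.range fun n => g^[n] (affineHomeomorph k d hk w)) =
      affineHomeomorph k d hk '' Set.range fun n => f^[n] w := by
    rw [← Set.range_comp]
    congr 1
    ext n
    exact ((hs.iterate_right n) w).symm
  rw [hrange]
  refine ⟨fun hb => ?_, fun hb => hlip.isBounded_image hb⟩
  have := hlip'.isBounded_image hb
  rwa [← Set.image_comp, Homeomorph.symm_comp_self, Set.image_id] at this

/-- For a finite simple graph with independence number 3 whose reduced
independence polynomial is `P(z) = a₁z + a₂z² + a₃z³`, if `a₁ ≥ 4` and
`a₂²·(a₁−3) = 4·a₃·(a₁−2)²`, then the Julia set of `P` is connected when `a₁ ≤ 7`, and is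
not connected but not totally disconnected when `a₁ > 7`. -/
theorem stmt_8 {V : Type*} [Fintype V] [DecidableEq V]
    (G : SimpleGraph V) [DecidableRel G.Adj]
    (a₁ a₂ a₃ : ℕ)
    (ha₁ : a₁ = Fintype.card V)
    (ha₂ : a₂ = (Finset.univ.filter
      (fun s : Finset V => s.card = 2 ∧ ∀ u ∈ s, ∀ v ∈ s, ¬ G.Adj u v)).card)
    (ha₃ : a₃ = (Finset.univ.filter
      (fun s : Finset V => s.card = 3 ∧ ∀ u ∈ s, ∀ v ∈ s, ¬ G.Adj u v)).card)
    (hindep3 : ∃ s : Finset V, s.card = 3 ∧ ∀ u ∈ s, ∀ v ∈ s, ¬ G.Adj u v)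
    (hindep4 : ¬ ∃ s : Finset V, s.card = 4 ∧ ∀ u ∈ s, ∀ v ∈ s, ¬ G.Adj u v)
    (P : ℂ → ℂ)
    (hP : ∀ z, P z = a₁ * z + a₂ * z ^ 2 + a₃ * z ^ 3)
    (ha : 4 ≤ a₁)
    (heq : (a₂ : ℤ) ^ 2 * ((a₁ : ℤ) - 3) = 4 * a₃ * ((a₁ : ℤ) - 2) ^ 2) :
    (a₁ ≤ 7 →
      IsConnected
        (frontier {z : ℂ | Bornology.IsBounded (Set.range fun n => P^[n] z)})) ∧
    (7 < a₁ →
      ¬ IsConnected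
          (frontier {z : ℂ | Bornology.IsBounded (Set.range fun n => P^[n] z)}) ∧
        ∃ t ⊆ frontier {z : ℂ | Bornology.IsBounded (Set.range fun n => P^[n] z)},
          IsPreconnected t ∧ ∃ x ∈ t, ∃ y ∈ t, x ≠ y) := by
  have ha₃pos : 0 < a₃ := by
    obtain ⟨s, hs⟩ := hindep3
    rw [ha₃]
    exact Finset.card_pos.2 ⟨s, Finset.mem_filter.2 ⟨Finset.mem_univ _, hs⟩⟩
  let b : ℝ := (a₁ : ℝ) - 3
  have ha' : (4 : ℝ) ≤ a₁ := by exact_mod_cast ha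
  have hb : 1 ≤ b := by simp only [b]; linarith
  have hb0 : 0 < b := by linarith
  have ha₃' : (0 : ℝ) < a₃ := by exact_mod_cast ha₃pos
  let q : ℝ := Real.sqrt (a₃ * b)
  have hq : 0 < q := Real.sqrt_pos.2 (by positivity)
  have hq2 : q ^ 2 = a₃ * b := Real.sq_sqrt (by positivity)
  have heq' : (a₂ : ℝ) ^ 2 * b = 4 * a₃ * (b + 1) ^ 2 := by
    have : (a₂ : ℝ) ^ 2 * ((a₁ : ℝ) - 3) = 4 * a₃ * ((a₁ : ℝ) - 2) ^ 2 := by exact_mod_cast heq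
    simp only [b]
    linear_combination this
  have ha₂' : (a₂ : ℝ) * b = 2 * (b + 1) * q := by
    refine (pow_left_inj₀ (by positivity) (by positivity) two_ne_zero).1 ?_
    linear_combination b * heq' - 4 * (b + 1) ^ 2 * hq2
  have hqC : (q : ℂ) ≠ 0 := by exact_mod_cast hq.ne'
  have hbC : (b : ℂ) ≠ 0 := by exact_mod_cast hb0.ne'
  have ha₁C : (a₁ : ℂ) = b + 3 := by simp [b]
  have ha₂C : (a₂ : ℂ) = 2 * (b + 1) * q / b := by
    rw [eq_div_iff hbC]
    exact_mod_cast ha₂'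
  have ha₃C : (a₃ : ℂ) = q ^ 2 / b := by
    rw [eq_div_iff hbC]
    exact_mod_cast hq2.symm
  have hconj : ∀ z, P ((q : ℂ)⁻¹ * z + -(b / q)) = (q : ℂ)⁻¹ * cubic (b : ℂ) z + -(b / q) := by
    intro z
    rw [hP, ha₁C, ha₂C, ha₃C, cubic]
    field_simp
    ring
  have hK := filledJulia_eq_image_of_semiconj (inv_ne_zero hqC) hconj
  change (a₁ ≤ 7 → IsConnected (frontier (filledJulia P))) ∧
    (7 < a₁ → ¬ IsConnected (frontier (filledJulia P)) ∧
      ∃ t ⊆ frontier (filledJulia P), IsPreconnected t ∧ ∃ x ∈ t, ∃ y ∈ t, x ≠ y)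
  set φ := affineHomeomorph (q : ℂ)⁻¹ (-(b / q)) (inv_ne_zero hqC)
  rw [hK, ← φ.image_frontier]
  refine ⟨fun h7 => ?_, fun h7 => ⟨fun hcon => ?_, ?_⟩⟩
  · have h7' : (a₁ : ℝ) ≤ 7 := by exact_mod_cast h7
    exact φ.isConnected_image.2
      (isConnected_frontier_filledJulia_cubic hb (by simp only [b]; linarith))
  · have h7' : (8 : ℝ) ≤ a₁ := by exact_mod_cast h7
    exact not_isPreconnected_frontier_filledJulia_cubic (by simp only [b]; linarith)
      (φ.isConnected_image.1 hcon).isPreconnected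
  · have h7' : (8 : ℝ) ≤ a₁ := by exact_mod_cast h7
    obtain ⟨t, ht, htc, x, hx, y, hy, hxy⟩ :=
      exists_isPreconnected_subset_frontier_cubic (b := b) (by simp only [b]; linarith)
    exact ⟨φ '' t, Set.image_mono ht, htc.image _ φ.continuous.continuousOn, φ x,
      ⟨x, hx, rfl⟩, φ y, ⟨y, hy, rfl⟩, φ.injective.ne hxy⟩
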